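/- A topological space X is sober (T0 and quasi-sober) if and only if the evaluation map e : X → ((Opens X) → Prop) defined by e(x)(U) = (x ∈ U), into the (Opens X)-fold power of the Sierpiński space with the product topology, is a topological embedding whose image e(X) is b-closed in the product. -/

import Mathlib

/-- The b-closure of a subset `M` of a topological space: the set of points `y` such that
any two open sets agreeing on `M` cannot separate `y`. -/
def bClosure {Y : Type*} [TopologicalSpace Y] (M : Set Y) : Set Y :=
  {y : Y | ∀ U V : Set Y, IsOpen U → IsOpen V → U ∩ M = V ∩ M → (y ∈ U ↔ y ∈ V)}

open TopologicalSpace Topology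

lemma subset_bClosure {Y : Type*} [TopologicalSpace Y] (M : Set Y) : M ⊆ bClosure M :=
  fun y hy U V _ _ h => by
    have := Set.ext_iff.1 h y
    simpa [hy] using this

/-- A point lies in the b-closure of a range if and only if open sets with the same preimage
cannot be distinguished by it. -/
lemma mem_bClosure_range {X Y : Type*} [TopologicalSpace Y] {f : X → Y} {y : Y} :
    y ∈ bClosure (Set.range f) ↔
      ∀ U V : Set Y, IsOpen U → IsOpen V → f ⁻¹' U = f ⁻¹' V → (y ∈ U ↔ y ∈ V) := by
  have key (U V : Set Y) : U ∩ Set.range f = V ∩ Set.range f ↔ f ⁻¹' U = f ⁻¹' V := by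
    rw [← Set.preimage_eq_preimage' (f := f) Set.inter_subset_right Set.inter_subset_right,
      Set.preimage_inter_range, Set.preimage_inter_range]
  simp only [bClosure, Set.mem_ofPred_eq, key]

lemma isOpen_setOf_apply {ι : Type*} (i : ι) : IsOpen {q : ι → Prop | q i} :=
  continuous_Prop.1 (continuous_apply i)

lemma specializes_pi_prop {ι : Type*} {p q : ι → Prop} (h : ∀ i, q i → p i) : p ⤳ q := by
  refine specializes_pi.2 fun i => ?_
  by_cases hq : q i
  · rw [eq_true hq, eq_true (h i hq)]
  · simp [Specializes, eq_false hq]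

section Evaluation

variable {X : Type*} [TopologicalSpace X]

/-- A point of the b-closure of the image of the evaluation map is a completely prime filter,
hence, in a quasi-sober space, the neighbourhood filter of a point. -/
lemma mem_range_of_mem_bClosure [QuasiSober X] {p : Opens X → Prop}
    (hp : p ∈ bClosure (Set.range (fun (x : X) (U : Opens X) => (x ∈ U : Prop)))) :
    p ∈ Set.range (fun (x : X) (U : Opens X) => (x ∈ U : Prop)) := by
  rw [mem_bClosure_range] at hp
  have p_top : p ⊤ := (hp {q | q ⊤} Set.univ (isOpen_setOf_apply _) isOpen_univ
    (by ext; simp)).2 trivial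
  have p_inf (U V : Opens X) : p (U ⊓ V) ↔ p U ∧ p V :=
    hp {q | q (U ⊓ V)} ({q | q U} ∩ {q | q V}) (isOpen_setOf_apply _)
      ((isOpen_setOf_apply _).inter (isOpen_setOf_apply _)) (by ext; simp)
  have p_sSup (A : Set (Opens X)) : p (sSup A) ↔ ∃ U ∈ A, p U := by
    simpa using hp {q | q (sSup A)} (⋃ U ∈ A, {q | q U}) (isOpen_setOf_apply _)
      (isOpen_biUnion fun U _ => isOpen_setOf_apply U) (by ext; simp)
  set G : Opens X := sSup {U | ¬ p U} with hG
  have p_iff (U : Opens X) : p U ↔ ((G : Set X)ᶜ ∩ U).Nonempty := by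
    have not_G : ¬ p G := by simp [hG, p_sSup]
    have : ((G : Set X)ᶜ ∩ U).Nonempty ↔ ¬ U ≤ G := by
      rw [Set.inter_comm, Set.inter_compl_nonempty_iff]; rfl
    rw [this]
    refine ⟨fun hU hle => not_G ?_, fun h => by_contra fun hU => h (le_sSup hU)⟩
    rw [← inf_eq_left.2 hle, p_inf] at hU
    exact hU.2
  have irred : IsIrreducible (G : Set X)ᶜ := by
    refine ⟨((p_iff ⊤).1 p_top).left, fun U V hU hV hGU hGV => ?_⟩
    have h := (p_inf ⟨U, hU⟩ ⟨V, hV⟩).2 ⟨(p_iff ⟨U, hU⟩).2 hGU, (p_iff ⟨V, hV⟩).2 hGV⟩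
    exact (p_iff _).1 h
  obtain ⟨x, hx⟩ := QuasiSober.sober irred G.isOpen.isClosed_compl
  exact ⟨x, funext fun U => propext ((hx.mem_open_set_iff U.isOpen).trans (p_iff U).symm)⟩

/-- An irreducible set, viewed as a point of the power of the Sierpiński space, is a generic
point of its image under the evaluation map. -/
lemma meets_mem_iff_of_isIrreducible {S : Set X} (hS : IsIrreducible S)
    {W : Set (Opens X → Prop)} (hW : IsOpen W) :
    (fun U : Opens X => (S ∩ U).Nonempty) ∈ W ↔
      (S ∩ (fun (x : X) (U : Opens X) => (x ∈ U : Prop)) ⁻¹' W).Nonempty := by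
  classical
  constructor
  · intro hp
    obtain ⟨I, u, hu, hIW⟩ := isOpen_pi_iff.1 hW _ hp
    obtain ⟨x, hxS, hx⟩ := isIrreducible_iff_sInter.1 hS
      ((I.filter fun U : Opens X => (S ∩ (U : Set X)).Nonempty).image (fun U : Opens X => (U : Set X)))
      (by simp only [Finset.mem_image]; rintro _ ⟨U, -, rfl⟩; exact U.isOpen)
      (by
        simp only [Finset.mem_image, Finset.mem_filter]
        rintro _ ⟨U, ⟨-, hU⟩, rfl⟩; exact hU)
    refine ⟨x, hxS, hIW fun U hU => ?_⟩
    have hxU : (x ∈ U) = (S ∩ (U : Set X)).Nonempty :=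
      propext ⟨fun h => ⟨x, hxS, h⟩, fun h => hx _ (by
        simp only [Finset.coe_image, Set.mem_image]
        exact ⟨U, Finset.mem_coe.2 (Finset.mem_filter.2 ⟨hU, h⟩), rfl⟩)⟩
    simpa only [hxU] using (hu U hU).2
  · rintro ⟨x, hxS, hxW⟩
    exact (specializes_pi_prop fun U hU => ⟨x, hxS, hU⟩).mem_open hW hxW

lemma quasiSober_of_bClosure_subset
    (h : bClosure (Set.range (fun (x : X) (U : Opens X) => (x ∈ U : Prop))) ⊆
      Set.range (fun (x : X) (U : Opens X) => (x ∈ U : Prop))) : QuasiSober X := by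
  refine ⟨fun {S} hS hSc => ?_⟩
  obtain ⟨x, hx⟩ := @h (fun U : Opens X => (S ∩ U).Nonempty)
    (mem_bClosure_range.2 fun W W' hW hW' hWW' => by
      rw [meets_mem_iff_of_isIrreducible hS hW, meets_mem_iff_of_isIrreducible hS hW', hWW'])
  have hx (U : Set X) (hU : IsOpen U) : x ∈ U ↔ (S ∩ U).Nonempty :=
    iff_of_eq (congrFun hx ⟨U, hU⟩)
  have hxS : x ∈ S := by
    by_contra hxS
    simpa using (hx Sᶜ hSc.isOpen_compl).1 hxS
  refine ⟨x, (isGenericPoint_iff_forall_closed hSc hxS).2 fun Z hZ hxZ => ?_⟩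
  rw [← Set.not_nonempty_iff_eq_empty.trans Set.sdiff_eq_empty, Set.sdiff_eq,
    ← hx _ hZ.isOpen_compl]
  exact not_not.2 hxZ

end Evaluation

/-- A topological space `X` is sober (T0 and quasi-sober) if and only if the evaluation map
`e : X → (Opens X → Prop)`, `e(x)(U) = (x ∈ U)`, into the `Opens X`-fold power of the
Sierpiński space, is a topological embedding whose image is b-closed in the product. -/
theorem sober_iff_bClosed_embedding_in_power (X : Type*) [TopologicalSpace X] :
    (T0Space X ∧ QuasiSober X) ↔
      (IsEmbedding (fun (x : X) (U : Opens X) => (x ∈ U : Prop)) ∧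
        bClosure (Set.range (fun (x : X) (U : Opens X) => (x ∈ U : Prop)))
          = Set.range (fun (x : X) (U : Opens X) => (x ∈ U : Prop))) := by
  constructor
  · rintro ⟨_, _⟩
    exact ⟨productOfMemOpens_isEmbedding X,
      Set.Subset.antisymm (fun _ => mem_range_of_mem_bClosure) (subset_bClosure _)⟩
  · rintro ⟨he, hb⟩
    exact ⟨he.t0Space, quasiSober_of_bClosure_subset hb.subset⟩
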